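/- arXiv:1501.00478 — 9 statements merged into one kernel-verified Lean document; each statement's English description precedes it below -/
import Mathlib

section
/- Let A and B be positive semidefinite (p+N)×(p+N) real matrices and let δ := max_{1≤i,j≤p+N} |A_{ij} − B_{ij}|. Fix integers r₁ ∈ {1,…,p} and r₂ ∈ {1,…,N} and a real number κ ≥ 0. Suppose that for every R₁ ⊆ {1,…,p} with |R₁| ≤ r₁ and every R₂ ⊆ {1,…,N} with |R₂| ≤ r₂, setting R = R₁ ∪ {p+i : i ∈ R₂}, every x ∈ ℝ^{p+N} with x ≠ 0 and ‖x_{Rᶜ}‖₁ ≤ 4‖x_R‖₁ satisfies x'Ax ≥ κ·‖x_R‖₁²/(r₁+r₂). Then for every such R₁, R₂, R and every such x one has x'Bx ≥ (κ − 25·δ·(r₁+r₂))·‖x_R‖₁²/(r₁+r₂). -/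
open Finset Matrix

/-- Quadratic forms of two matrices that are entrywise `d`-close differ by at most
`d` times the squared `ℓ₁` norm. -/
theorem dotProduct_mulVec_sub_le {ι : Type*} [Fintype ι] {A B : Matrix ι ι ℝ} {d : ℝ}
    (h : ∀ i j, |A i j - B i j| ≤ d) (x : ι → ℝ) :
    x ⬝ᵥ A.mulVec x - x ⬝ᵥ B.mulVec x ≤ d * (∑ i, |x i|) ^ 2 := by
  simp only [dotProduct, mulVec, sq, Finset.sum_mul_sum]
  simp only [Finset.mul_sum, ← Finset.sum_sub_distrib]
  refine Finset.sum_le_sum fun i _ => Finset.sum_le_sum fun j _ => ?_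
  calc x i * (A i j * x j) - x i * (B i j * x j)
      = (A i j - B i j) * (x i * x j) := by ring
    _ ≤ |(A i j - B i j) * (x i * x j)| := le_abs_self _
    _ = |A i j - B i j| * (|x i| * |x j|) := by rw [abs_mul, abs_mul]
    _ ≤ d * (|x i| * |x j|) := by gcongr; exact h i j

/-- Lemma on transfer of the panel compatibility constant between two
close positive semidefinite matrices. -/
theorem stmt3
    (p N : ℕ)
    (A B : Matrix (Fin p ⊕ Fin N) (Fin p ⊕ Fin N) ℝ)
    (hAsymm : A.IsSymm) (hBsymm : B.IsSymm)
    (hApsd : ∀ x : Fin p ⊕ Fin N → ℝ, 0 ≤ x ⬝ᵥ A.mulVec x)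
    (hBpsd : ∀ x : Fin p ⊕ Fin N → ℝ, 0 ≤ x ⬝ᵥ B.mulVec x)
    -- `d` is the maximal absolute entrywise difference between `A` and `B`
    (d : ℝ) (hd : IsGreatest {t : ℝ | ∃ i j, t = |A i j - B i j|} d)
    (r₁ r₂ : ℕ) (hr₁1 : 1 ≤ r₁) (hr₁p : r₁ ≤ p) (hr₂1 : 1 ≤ r₂) (hr₂N : r₂ ≤ N)
    (κ : ℝ) (hκ : 0 ≤ κ)
    (hcompatA : ∀ (R₁ : Finset (Fin p)) (R₂ : Finset (Fin N)),
      R₁.card ≤ r₁ → R₂.card ≤ r₂ →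
      ∀ x : Fin p ⊕ Fin N → ℝ, x ≠ 0 →
      (∑ k ∈ (R₁.image Sum.inl ∪ R₂.image Sum.inr)ᶜ, |x k|)
        ≤ 4 * ∑ k ∈ R₁.image Sum.inl ∪ R₂.image Sum.inr, |x k| →
      κ * (∑ k ∈ R₁.image Sum.inl ∪ R₂.image Sum.inr, |x k|) ^ 2 / (r₁ + r₂ : ℝ)
        ≤ x ⬝ᵥ A.mulVec x) :
    ∀ (R₁ : Finset (Fin p)) (R₂ : Finset (Fin N)),
      R₁.card ≤ r₁ → R₂.card ≤ r₂ →
      ∀ x : Fin p ⊕ Fin N → ℝ, x ≠ 0 →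
      (∑ k ∈ (R₁.image Sum.inl ∪ R₂.image Sum.inr)ᶜ, |x k|)
        ≤ 4 * ∑ k ∈ R₁.image Sum.inl ∪ R₂.image Sum.inr, |x k| →
      (κ - 25 * d * (r₁ + r₂ : ℝ))
          * (∑ k ∈ R₁.image Sum.inl ∪ R₂.image Sum.inr, |x k|) ^ 2 / (r₁ + r₂ : ℝ)
        ≤ x ⬝ᵥ B.mulVec x := by
  intro R₁ R₂ h₁ h₂ x hx hcone
  have hA := hcompatA R₁ R₂ h₁ h₂ x hx hcone
  have hentry : ∀ i j, |A i j - B i j| ≤ d := fun i j => hd.2 ⟨i, j, rfl⟩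
  have hd0 : 0 ≤ d := by
    obtain ⟨i, j, hij⟩ := hd.1
    exact hij ▸ abs_nonneg _
  have hclose := dotProduct_mulVec_sub_le hentry x
  have hsplit := Finset.sum_add_sum_compl (R₁.image Sum.inl ∪ R₂.image Sum.inr) fun k => |x k|
  set s := ∑ k ∈ R₁.image Sum.inl ∪ R₂.image Sum.inr, |x k|
  have hnorm : (∑ k, |x k|) ^ 2 ≤ (5 * s) ^ 2 := by
    have h0 : 0 ≤ ∑ k, |x k| := Finset.sum_nonneg fun k _ => abs_nonneg _
    gcongr
    linarith
  have hr : (0 : ℝ) < r₁ + r₂ := by positivity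
  have hexpand : (κ - 25 * d * (r₁ + r₂ : ℝ)) * s ^ 2 / (r₁ + r₂ : ℝ)
      = κ * s ^ 2 / (r₁ + r₂ : ℝ) - d * (5 * s) ^ 2 := by
    field_simp
    ring
  rw [hexpand]
  linarith [mul_le_mul_of_nonneg_left hnorm hd0]
end

section
/- Let A and B be positive semidefinite m×m real matrices and let δ := max_{1≤l,k≤m} |A_{lk} − B_{lk}|. Fix an integer r ∈ {1,…,m} and a real number κ ≥ 0. Suppose that for every R ⊆ {1,…,m} with |R| ≤ r, every x ∈ ℝ^m with x ≠ 0 and ‖x_{Rᶜ}‖₁ ≤ 3‖x_R‖₁ satisfies x'Ax ≥ κ·‖x_R‖₁²/r. Then for every such R and x one has x'Bx ≥ (κ − 16·δ·r)·‖x_R‖₁²/r. -/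
open Finset Matrix

/-- A quadratic form whose matrix has entries bounded by `d` is at most `d` times the squared
`ℓ₁` norm. -/
theorem dotProduct_mulVec_le_of_abs_le {n : Type*} [Fintype n] (M : Matrix n n ℝ) (d : ℝ)
    (hM : ∀ l k, |M l k| ≤ d) (x : n → ℝ) :
    x ⬝ᵥ M.mulVec x ≤ d * (∑ k, |x k|) ^ 2 := by
  have hrhs : d * (∑ k, |x k|) ^ 2 = ∑ l, ∑ k, |x l| * (d * |x k|) := by
    rw [sq, Finset.sum_mul_sum, Finset.mul_sum]
    refine Finset.sum_congr rfl fun l _ => ?_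
    rw [Finset.mul_sum]
    exact Finset.sum_congr rfl fun k _ => by ring
  rw [hrhs]
  simp only [dotProduct, Matrix.mulVec, Finset.mul_sum]
  refine Finset.sum_le_sum fun l _ => Finset.sum_le_sum fun k _ => ?_
  refine (le_abs_self _).trans ?_
  rw [abs_mul, abs_mul]
  gcongr
  exact hM l k

/-- Proposition: transfer of the compatibility constant between two close
positive semidefinite `m × m` matrices, with constants 3 and 16. -/
theorem stmt4
    (m : ℕ)
    (A B : Matrix (Fin m) (Fin m) ℝ)
    (hAsymm : A.IsSymm) (hBsymm : B.IsSymm)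
    (hApsd : ∀ x : Fin m → ℝ, 0 ≤ x ⬝ᵥ A.mulVec x)
    (hBpsd : ∀ x : Fin m → ℝ, 0 ≤ x ⬝ᵥ B.mulVec x)
    -- `d` is the maximal absolute entrywise difference between `A` and `B`
    (d : ℝ) (hd : IsGreatest {t : ℝ | ∃ l k, t = |A l k - B l k|} d)
    (r : ℕ) (hr1 : 1 ≤ r) (hrm : r ≤ m)
    (κ : ℝ) (hκ : 0 ≤ κ)
    (hcompatA : ∀ R : Finset (Fin m), R.card ≤ r →
      ∀ x : Fin m → ℝ, x ≠ 0 →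
      (∑ k ∈ Rᶜ, |x k|) ≤ 3 * ∑ k ∈ R, |x k| →
      κ * (∑ k ∈ R, |x k|) ^ 2 / (r : ℝ) ≤ x ⬝ᵥ A.mulVec x) :
    ∀ R : Finset (Fin m), R.card ≤ r →
      ∀ x : Fin m → ℝ, x ≠ 0 →
      (∑ k ∈ Rᶜ, |x k|) ≤ 3 * ∑ k ∈ R, |x k| →
      (κ - 16 * d * (r : ℝ)) * (∑ k ∈ R, |x k|) ^ 2 / (r : ℝ) ≤ x ⬝ᵥ B.mulVec x := by
  intro R hR x hx hcone
  have hA := hcompatA R hR x hx hcone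
  have hdiff := dotProduct_mulVec_le_of_abs_le (A - B) d (fun l k => hd.2 ⟨l, k, rfl⟩) x
  rw [Matrix.sub_mulVec, dotProduct_sub] at hdiff
  have hd0 : 0 ≤ d := by
    obtain ⟨l, k, h⟩ := hd.1
    exact h ▸ abs_nonneg _
  have hr0 : (r : ℝ) ≠ 0 := by positivity
  have hnorm : ∑ k, |x k| ≤ 4 * ∑ k ∈ R, |x k| := by
    rw [← Finset.sum_add_sum_compl R]
    linarith
  have hsq : d * (∑ k, |x k|) ^ 2 ≤ d * (4 * ∑ k ∈ R, |x k|) ^ 2 := by gcongr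
  have hsplit : (κ - 16 * d * (r : ℝ)) * (∑ k ∈ R, |x k|) ^ 2 / (r : ℝ) =
      κ * (∑ k ∈ R, |x k|) ^ 2 / (r : ℝ) - d * (4 * ∑ k ∈ R, |x k|) ^ 2 := by
    field_simp
    ring
  linarith
end

section
/- Let Ψ_Z be a positive semidefinite p×p real matrix and let Ψ be the (p+N)×(p+N) block diagonal matrix diag(Ψ_Z, I_N). Fix integers r₁ ∈ {1,…,p}, r₂ ∈ {1,…,N}, sets R₁ ⊆ {1,…,p} with |R₁| ≤ r₁ and R₂ ⊆ {1,…,N} with |R₂| ≤ r₂, and set R = R₁ ∪ {p+i : i ∈ R₂}. Then for every δ = (δ₁', δ₂')' ∈ ℝ^{p+N} (δ₁ ∈ ℝ^p, δ₂ ∈ ℝ^N) with δ_{1,R₁} ≠ 0, one has δ'Ψδ · (r₁+r₂)/‖δ_R‖₁² ≥ min(1, δ₁'Ψ_Z δ₁ / ‖δ_{1,R₁}‖²). -/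
open Finset Matrix

theorem dotProduct_fromBlocks_one_mulVec_sumElim {m n : Type*} [Fintype m] [Fintype n]
    [DecidableEq n] (A : Matrix m m ℝ) (x : m → ℝ) (y : n → ℝ) :
    Sum.elim x y ⬝ᵥ (Matrix.fromBlocks A 0 0 (1 : Matrix n n ℝ)).mulVec (Sum.elim x y)
      = x ⬝ᵥ A.mulVec x + ∑ i, y i ^ 2 := by
  simp [Matrix.fromBlocks_mulVec, dotProduct, pow_two]

theorem sq_sum_abs_sumElim_le {m n : Type*} [DecidableEq m] [DecidableEq n]
    (s : Finset m) (t : Finset n) (x : m → ℝ) (y : n → ℝ) :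
    (∑ k ∈ s.image Sum.inl ∪ t.image Sum.inr, |Sum.elim x y k|) ^ 2
      ≤ (s.card + t.card : ℝ) * (∑ i ∈ s, x i ^ 2 + ∑ j ∈ t, y j ^ 2) := by
  have hdisj : Disjoint (s.image (Sum.inl : m → m ⊕ n)) (t.image Sum.inr) := by
    simp [Finset.disjoint_left]
  refine sq_sum_le_card_mul_sum_sq.trans_eq ?_
  rw [Finset.card_union_of_disjoint hdisj, Finset.sum_union hdisj,
    Finset.card_image_of_injective _ Sum.inl_injective,
    Finset.card_image_of_injective _ Sum.inr_injective,
    Finset.sum_image Sum.inl_injective.injOn, Finset.sum_image Sum.inr_injective.injOn]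
  simp

/-- for the block diagonal matrix `Ψ = diag(Ψ_Z, I_N)` the restricted
quadratic form ratio is bounded below by `min(1, δ₁'Ψ_Zδ₁/‖δ_{1,R₁}‖²)`. -/
theorem stmt5
    (p N : ℕ)
    (ΨZ : Matrix (Fin p) (Fin p) ℝ)
    (hsymm : ΨZ.IsSymm)
    (hpsd : ∀ x : Fin p → ℝ, 0 ≤ x ⬝ᵥ ΨZ.mulVec x)
    (r₁ r₂ : ℕ) (hr₁1 : 1 ≤ r₁) (hr₁p : r₁ ≤ p) (hr₂1 : 1 ≤ r₂) (hr₂N : r₂ ≤ N)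
    (R₁ : Finset (Fin p)) (hR₁ : R₁.card ≤ r₁)
    (R₂ : Finset (Fin N)) (hR₂ : R₂.card ≤ r₂)
    (δ₁ : Fin p → ℝ) (δ₂ : Fin N → ℝ)
    -- `δ_{1,R₁} ≠ 0`
    (hδ : ∃ j ∈ R₁, δ₁ j ≠ 0) :
    min 1 ((δ₁ ⬝ᵥ ΨZ.mulVec δ₁) / (∑ j ∈ R₁, (δ₁ j) ^ 2))
        * (∑ k ∈ R₁.image Sum.inl ∪ R₂.image Sum.inr, |Sum.elim δ₁ δ₂ k|) ^ 2
        / (r₁ + r₂ : ℝ)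
      ≤ Sum.elim δ₁ δ₂ ⬝ᵥ
          (Matrix.fromBlocks ΨZ 0 0 (1 : Matrix (Fin N) (Fin N) ℝ)).mulVec
            (Sum.elim δ₁ δ₂) := by
  rw [dotProduct_fromBlocks_one_mulVec_sumElim]
  have hS : 0 < ∑ j ∈ R₁, (δ₁ j) ^ 2 := by
    obtain ⟨j, hj, hne⟩ := hδ
    exact Finset.sum_pos' (fun _ _ => sq_nonneg _) ⟨j, hj, by positivity⟩
  have hT : 0 ≤ ∑ j ∈ R₂, (δ₂ j) ^ 2 := Finset.sum_nonneg fun _ _ => sq_nonneg _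
  have hTle : ∑ j ∈ R₂, (δ₂ j) ^ 2 ≤ ∑ j, (δ₂ j) ^ 2 :=
    Finset.sum_le_sum_of_subset_of_nonneg (Finset.subset_univ _) fun _ _ _ => sq_nonneg _
  have hcard : (R₁.card + R₂.card : ℝ) ≤ r₁ + r₂ := by exact_mod_cast add_le_add hR₁ hR₂
  have hr : (0 : ℝ) < r₁ + r₂ := by exact_mod_cast Nat.add_pos_left hr₁1 r₂
  have hl1 := (sq_sum_abs_sumElim_le R₁ R₂ δ₁ δ₂).trans
    (mul_le_mul_of_nonneg_right hcard (add_nonneg hS.le hT))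
  have hc0 : 0 ≤ min 1 ((δ₁ ⬝ᵥ ΨZ.mulVec δ₁) / (∑ j ∈ R₁, (δ₁ j) ^ 2)) :=
    le_min zero_le_one (div_nonneg (hpsd δ₁) hS.le)
  have hc1 := min_le_left 1 ((δ₁ ⬝ᵥ ΨZ.mulVec δ₁) / (∑ j ∈ R₁, (δ₁ j) ^ 2))
  have hcS := (le_div_iff₀ hS).1
    (min_le_right 1 ((δ₁ ⬝ᵥ ΨZ.mulVec δ₁) / (∑ j ∈ R₁, (δ₁ j) ^ 2)))
  have hcT := (mul_le_of_le_one_left hT hc1).trans hTle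
  rw [div_le_iff₀ hr]
  refine (mul_le_mul_of_nonneg_left hl1 hc0).trans ?_
  rw [mul_left_comm, mul_comm, mul_add (min _ _)]
  exact mul_le_mul_of_nonneg_right (add_le_add hcS hcT) hr.le
end

section
/- Let φ̂ be a minimizer over ℝ^m of the Lasso objective δ ↦ (1/n)‖z − Xδ‖² + 2λ‖δ‖₁. Then (1/n)‖z − Xφ̂‖² + λ‖φ̂‖₁ = (1/n)(z − Xφ̂)'z. -/
open Finset Matrix

/-- A quadratic without constant term that is nonnegative near `0` has no linear term. -/
theorem linear_coeff_eq_zero_of_nonneg_near_zero {a c : ℝ}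
    (h : ∀ t : ℝ, |t| ≤ 1 → 0 ≤ 2 * t * a + t ^ 2 * c) : a = 0 := by
  by_contra ha
  have hd : 0 < |a| + |c| + 1 := by positivity
  have ht : |-a / (|a| + |c| + 1)| ≤ 1 := by
    rw [abs_div, abs_neg, abs_of_pos hd, div_le_one hd]
    linarith [abs_nonneg c]
  have key := h _ ht
  have hrw : 2 * (-a / (|a| + |c| + 1)) * a + (-a / (|a| + |c| + 1)) ^ 2 * c
      = a ^ 2 * (c - 2 * (|a| + |c| + 1)) / (|a| + |c| + 1) ^ 2 := by
    field_simp
    ring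
  rw [hrw] at key
  have hneg : a ^ 2 * (c - 2 * (|a| + |c| + 1)) < 0 :=
    mul_neg_of_pos_of_neg (by positivity)
      (by linarith [le_abs_self c, abs_nonneg c, abs_nonneg a])
  exact absurd key (not_le.mpr (div_neg_of_neg_of_pos hneg (by positivity)))

/-- for a minimizer `φ̂` of the Lasso objective,
`(1/n)‖z − Xφ̂‖² + λ‖φ̂‖₁ = (1/n)(z − Xφ̂)'z`. -/
theorem stmt6
    (n m : ℕ) (hn : 0 < n) (hm : 0 < m)
    (X : Matrix (Fin n) (Fin m) ℝ) (z : Fin n → ℝ)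
    (lam : ℝ) (hlam : 0 < lam)
    (φhat : Fin m → ℝ)
    (hmin : ∀ δ : Fin m → ℝ,
      (1 / n) * (∑ i, (z i - X.mulVec φhat i) ^ 2) + 2 * lam * (∑ k, |φhat k|)
      ≤ (1 / n) * (∑ i, (z i - X.mulVec δ i) ^ 2) + 2 * lam * (∑ k, |δ k|)) :
    (1 / n) * (∑ i, (z i - X.mulVec φhat i) ^ 2) + lam * (∑ k, |φhat k|)
      = (1 / n) * (∑ i, (z i - X.mulVec φhat i) * z i) := by
  set v := X.mulVec φhat with hv
  have hz : ∑ i, (z i - v i) * z i = ∑ i, (z i - v i) ^ 2 + ∑ i, (z i - v i) * v i := by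
    rw [← Finset.sum_add_distrib]
    exact Finset.sum_congr rfl fun i _ => by ring
  have key : lam * ∑ k, |φhat k| - (1 / n) * ∑ i, (z i - v i) * v i = 0 := by
    refine linear_coeff_eq_zero_of_nonneg_near_zero (c := (1 / n) * ∑ i, v i ^ 2) fun t ht => ?_
    have h := hmin ((1 + t) • φhat)
    have hsq : ∑ i, (z i - X.mulVec ((1 + t) • φhat) i) ^ 2
        = ∑ i, (z i - v i) ^ 2 - 2 * t * ∑ i, (z i - v i) * v i + t ^ 2 * ∑ i, v i ^ 2 := by
      rw [Matrix.mulVec_smul, ← hv, Finset.mul_sum, Finset.mul_sum, ← Finset.sum_sub_distrib,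
        ← Finset.sum_add_distrib]
      exact Finset.sum_congr rfl fun i _ => by simp only [Pi.smul_apply, smul_eq_mul]; ring
    have habs : ∑ k, |((1 + t) • φhat) k| = (1 + t) * ∑ k, |φhat k| := by
      rw [Finset.mul_sum]
      refine Finset.sum_congr rfl fun k _ => ?_
      rw [Pi.smul_apply, smul_eq_mul, abs_mul, abs_of_nonneg (by linarith [(abs_le.mp ht).1])]
    rw [hsq, habs] at h
    linarith
  rw [hz]
  linarith
end

section
/- Let φ̂ be a minimizer over ℝ^m of the Lasso objective δ ↦ (1/n)‖z − Xδ‖² + 2λ‖δ‖₁. Then ‖(1/n)X'(z − Xφ̂)‖_∞ ≤ λ, where ‖·‖_∞ denotes the maximum absolute entry. -/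
open Finset Matrix

/-- If a quadratic with vanishing constant term plus an `ℓ₁` penalty has a minimum at `0`, its
linear coefficient is bounded by the penalty level. -/
theorem abs_le_of_forall_quadratic_add_abs_nonneg {g c lam : ℝ} (hc : 0 ≤ c)
    (h : ∀ t : ℝ, 2 * t * g ≤ t ^ 2 * c + 2 * lam * |t|) : |g| ≤ lam := by
  by_contra! hlt
  have key : ∀ s : ℝ, 0 < s → 2 * (|g| - lam) ≤ s * c := by
    intro s hs
    have hs' : 2 * s * |g| ≤ s ^ 2 * c + 2 * lam * s := by
      rcases abs_cases g with ⟨hg, -⟩ | ⟨hg, -⟩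
      · simpa [hg, abs_of_pos hs] using h s
      · simpa [hg, abs_of_pos hs] using h (-s)
    nlinarith
  have hd : 0 < |g| - lam := sub_pos.2 hlt
  have h1 := key ((|g| - lam) / (c + 1)) (by positivity)
  have h2 : (|g| - lam) / (c + 1) * c ≤ |g| - lam := by
    rw [div_mul_eq_mul_div, div_le_iff₀ (by positivity)]
    nlinarith
  linarith

/-- Moving a vector along a coordinate axis increases its `ℓ₁` norm by at most the step size. -/
theorem sum_abs_add_single_le {ι : Type*} [Fintype ι] [DecidableEq ι] (φ : ι → ℝ) (k : ι)
    (t : ℝ) : ∑ j, |(φ + Pi.single k t : ι → ℝ) j| ≤ ∑ j, |φ j| + |t| := by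
  calc ∑ j, |(φ + Pi.single k t : ι → ℝ) j|
      ≤ ∑ j, (|φ j| + |(Pi.single k t : ι → ℝ) j|) :=
        Finset.sum_le_sum fun j _ => abs_add_le _ _
    _ = ∑ j, |φ j| + |t| := by
        rw [Finset.sum_add_distrib,
          Fintype.sum_eq_single (f := fun j => |(Pi.single k t : ι → ℝ) j|) k]
          <;> simp +contextual

/-- Expansion of the residual sum of squares along a coordinate axis. -/
theorem sum_sq_sub_mulVec_add_single {ι κ : Type*} [Fintype ι] [Fintype κ] [DecidableEq κ]
    (X : Matrix ι κ ℝ) (z : ι → ℝ) (φ : κ → ℝ) (k : κ) (t : ℝ) :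
    ∑ i, (z i - X.mulVec (φ + Pi.single k t) i) ^ 2 =
      ∑ i, (z i - X.mulVec φ i) ^ 2 - 2 * t * ∑ i, X i k * (z i - X.mulVec φ i)
        + t ^ 2 * ∑ i, X i k ^ 2 := by
  rw [Finset.mul_sum, Finset.mul_sum, ← Finset.sum_sub_distrib, ← Finset.sum_add_distrib]
  refine Finset.sum_congr rfl fun i _ => ?_
  simp only [Matrix.mulVec_add, Pi.add_apply, Matrix.mulVec_single, Pi.smul_apply,
    Matrix.col_apply, MulOpposite.smul_eq_mul_unop, MulOpposite.unop_op]
  ring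

/-- KKT conditions for the generic Lasso: for a minimizer `φ̂`,
`‖(1/n)X'(z − Xφ̂)‖_∞ ≤ λ`. -/
theorem stmt8
    (n m : ℕ) (hn : 0 < n) (hm : 0 < m)
    (X : Matrix (Fin n) (Fin m) ℝ) (z : Fin n → ℝ)
    (lam : ℝ) (hlam : 0 < lam)
    (φhat : Fin m → ℝ)
    (hmin : ∀ δ : Fin m → ℝ,
      (1 / n) * (∑ i, (z i - X.mulVec φhat i) ^ 2) + 2 * lam * (∑ k, |φhat k|)
      ≤ (1 / n) * (∑ i, (z i - X.mulVec δ i) ^ 2) + 2 * lam * (∑ k, |δ k|)) :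
    ∀ k, |(1 / n) * ∑ i, X i k * (z i - X.mulVec φhat i)| ≤ lam := by
  intro k
  refine abs_le_of_forall_quadratic_add_abs_nonneg
    (c := (1 / n) * ∑ i, X i k ^ 2) (by positivity) fun t => ?_
  have h := hmin (φhat + Pi.single k t)
  rw [sum_sq_sub_mulVec_add_single] at h
  have hl := mul_le_mul_of_nonneg_left (sum_abs_add_single_le φhat k t)
    (by positivity : 0 ≤ 2 * lam)
  linarith
end

section
/- Let Z be an n×p real matrix, fix j ∈ {1,…,p}, let z_j be the j-th column of Z and Z_{−j} the n×(p−1) matrix obtained by deleting the j-th column. Let λ > 0 and let φ̂_j ∈ ℝ^{p−1} be a minimizer of δ ↦ (1/n)‖z_j − Z_{−j}δ‖² + 2λ‖δ‖₁. Define τ̂_j² := (1/n)‖z_j − Z_{−j}φ̂_j‖² + λ‖φ̂_j‖₁, and let Θ̂_j ∈ ℝ^p be the vector whose j-th entry is 1/τ̂_j² and whose k-th entry (k ≠ j) is −φ̂_{j,k}/τ̂_j², where φ̂_{j,k} is the coordinate of φ̂_j corresponding to column k of Z. If τ̂_j² > 0, then (1/n)·z_j'·Z·Θ̂_j = 1 and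 ‖(1/n)·Z'Z·Θ̂_j − e_j‖_∞ ≤ λ/τ̂_j², where e_j is the j-th standard basis vector of ℝ^p. -/
open Finset Matrix

theorem le_of_forall_mul_le_sq_mul_add {a b q : ℝ}
    (h : ∀ t : ℝ, 0 < t → t ≤ 1 → t * a ≤ t ^ 2 * q + t * b) : a ≤ b := by
  by_contra! hab
  have hq : 0 < 2 * (|q| + 1) := by positivity
  have hs : 0 < min 1 ((a - b) / (2 * (|q| + 1))) :=
    lt_min one_pos (div_pos (sub_pos.2 hab) hq)
  have hle := (le_div_iff₀ hq).1 (min_le_right 1 ((a - b) / (2 * (|q| + 1))))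
  have hmul := h _ hs (min_le_left _ _)
  set t := min 1 ((a - b) / (2 * (|q| + 1)))
  have ht : a ≤ t * q + b := le_of_mul_le_mul_left (by linarith) hs
  nlinarith [mul_le_mul_of_nonneg_left (le_abs_self q) hs.le]

/-- First-order condition for the Lasso in a direction `d` along which the `ℓ₁` norm grows at
rate at most `b`. -/
theorem lasso_correlation_le {ι κ : Type*} [Fintype ι] [Fintype κ]
    (A : Matrix ι κ ℝ) (z : ι → ℝ) (c lam : ℝ) (hlam : 0 ≤ lam) (φ : κ → ℝ)
    (hmin : ∀ δ : κ → ℝ,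
      c * (∑ i, (z i - A.mulVec φ i) ^ 2) + 2 * lam * (∑ k, |φ k|)
        ≤ c * (∑ i, (z i - A.mulVec δ i) ^ 2) + 2 * lam * (∑ k, |δ k|))
    (d : κ → ℝ) (b : ℝ)
    (hd : ∀ t : ℝ, 0 < t → t ≤ 1 → ∑ k, |φ k + t * d k| ≤ ∑ k, |φ k| + t * b) :
    c * ∑ i, A.mulVec d i * (z i - A.mulVec φ i) ≤ lam * b := by
  have key : 2 * (c * ∑ i, A.mulVec d i * (z i - A.mulVec φ i)) ≤ 2 * (lam * b) := by
    refine le_of_forall_mul_le_sq_mul_add (q := c * ∑ i, A.mulVec d i ^ 2) fun t ht ht1 => ?_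
    have hm := hmin (φ + t • d)
    have hexp : ∑ i, (z i - A.mulVec (φ + t • d) i) ^ 2
        = ∑ i, (z i - A.mulVec φ i) ^ 2
          - 2 * t * ∑ i, A.mulVec d i * (z i - A.mulVec φ i)
          + t ^ 2 * ∑ i, A.mulVec d i ^ 2 := by
      rw [mul_sum, mul_sum, ← sum_sub_distrib, ← sum_add_distrib]
      refine sum_congr rfl fun i _ => ?_
      rw [mulVec_add, mulVec_smul, Pi.add_apply, Pi.smul_apply, smul_eq_mul]
      ring
    have hnorm := mul_le_mul_of_nonneg_left (hd t ht ht1) hlam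
    simp only [Pi.add_apply, Pi.smul_apply, smul_eq_mul] at hm
    rw [hexp] at hm
    linarith
  linarith

theorem lasso_correlation_self {ι κ : Type*} [Fintype ι] [Fintype κ]
    (A : Matrix ι κ ℝ) (z : ι → ℝ) (c lam : ℝ) (hlam : 0 ≤ lam) (φ : κ → ℝ)
    (hmin : ∀ δ : κ → ℝ,
      c * (∑ i, (z i - A.mulVec φ i) ^ 2) + 2 * lam * (∑ k, |φ k|)
        ≤ c * (∑ i, (z i - A.mulVec δ i) ^ 2) + 2 * lam * (∑ k, |δ k|)) :
    c * ∑ i, A.mulVec φ i * (z i - A.mulVec φ i) = lam * ∑ k, |φ k| := by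
  apply le_antisymm
  · refine lasso_correlation_le A z c lam hlam φ hmin φ _ fun t ht _ => ?_
    rw [mul_sum, ← sum_add_distrib]
    refine sum_le_sum fun k _ => (abs_add_le _ _).trans_eq ?_
    rw [abs_mul, abs_of_pos ht]
  · have h := lasso_correlation_le A z c lam hlam φ hmin (-φ) (-∑ k, |φ k|) fun t ht ht1 => by
      rw [← sum_neg_distrib, mul_sum, ← sum_add_distrib]
      refine sum_le_sum fun k _ => ?_
      rw [Pi.neg_apply, show φ k + t * -φ k = (1 - t) * φ k by ring, abs_mul,
        abs_of_nonneg (sub_nonneg.2 ht1)]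
      linarith
    simp only [mulVec_neg, Pi.neg_apply, neg_mul, sum_neg_distrib, mul_neg] at h
    linarith

theorem abs_lasso_correlation_le {ι κ : Type*} [Fintype ι] [Fintype κ]
    (A : Matrix ι κ ℝ) (z : ι → ℝ) (c lam : ℝ) (hlam : 0 ≤ lam) (φ : κ → ℝ)
    (hmin : ∀ δ : κ → ℝ,
      c * (∑ i, (z i - A.mulVec φ i) ^ 2) + 2 * lam * (∑ k, |φ k|)
        ≤ c * (∑ i, (z i - A.mulVec δ i) ^ 2) + 2 * lam * (∑ k, |δ k|)) (k : κ) :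
    |c * ∑ i, A i k * (z i - A.mulVec φ i)| ≤ lam := by
  classical
  have h (s : ℝ) (hs : |s| = 1) :
      c * ∑ i, A.mulVec (Pi.single k s) i * (z i - A.mulVec φ i) ≤ lam * 1 := by
    refine lasso_correlation_le A z c lam hlam φ hmin _ _ fun t ht _ => ?_
    calc ∑ l, |φ l + t * (Pi.single k s : κ → ℝ) l|
        ≤ ∑ l, (|φ l| + if l = k then t else 0) := by
          refine sum_le_sum fun l _ => (abs_add_le _ _).trans_eq ?_
          rcases eq_or_ne l k with rfl | hl
          · simp [abs_mul, hs, abs_of_pos ht]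
          · simp [hl]
      _ = ∑ l, |φ l| + t * 1 := by simp [sum_add_distrib]
  have h1 := h 1 (by simp)
  have h2 := h (-1) (by simp)
  simp only [mulVec_single, Pi.smul_apply, MulOpposite.op_one, one_smul, MulOpposite.op_neg,
    neg_smul, neg_mul, sum_neg_distrib, mul_neg, col_apply, mul_one] at h1 h2
  exact abs_le.2 ⟨by linarith, h1⟩

/-- nodewise regression identities: for the nodewise Lasso estimate
`φ̂_j` with `τ̂_j² > 0` and `Θ̂_j` the corresponding row of the approximate inverse,
`(1/n)·z_j'·Z·Θ̂_j = 1` and `‖(1/n)·Z'Z·Θ̂_j − e_j‖_∞ ≤ λ/τ̂_j²`. -/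
theorem stmt9
    (n p : ℕ) (hn : 0 < n) (hp : 0 < p)
    (Z : Matrix (Fin n) (Fin p) ℝ) (j : Fin p)
    (lam : ℝ) (hlam : 0 < lam)
    (φhat : {k : Fin p // k ≠ j} → ℝ)
    -- `φ̂_j` minimizes the nodewise Lasso objective, where `Z_{−j}` is `Z` without
    -- its `j`-th column
    (hmin : ∀ δ : {k : Fin p // k ≠ j} → ℝ,
      (1 / n) * (∑ i, (Z i j -
          (Z.submatrix id (Subtype.val : {k : Fin p // k ≠ j} → Fin p)).mulVec φhat i) ^ 2)
        + 2 * lam * (∑ k, |φhat k|)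
      ≤ (1 / n) * (∑ i, (Z i j -
          (Z.submatrix id (Subtype.val : {k : Fin p // k ≠ j} → Fin p)).mulVec δ i) ^ 2)
        + 2 * lam * (∑ k, |δ k|))
    (τ2 : ℝ)
    (hτ2 : τ2 = (1 / n) * (∑ i, (Z i j -
          (Z.submatrix id (Subtype.val : {k : Fin p // k ≠ j} → Fin p)).mulVec φhat i) ^ 2)
        + lam * (∑ k, |φhat k|))
    (hτpos : 0 < τ2)
    (Θhat : Fin p → ℝ)
    (hΘj : Θhat j = 1 / τ2)
    (hΘk : ∀ (k : Fin p) (h : k ≠ j), Θhat k = -φhat ⟨k, h⟩ / τ2) :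
    ((1 / n) * (∑ i, Z i j * Z.mulVec Θhat i) = 1)
    ∧ ∀ k : Fin p,
        |(1 / n) * (∑ i, Z i k * Z.mulVec Θhat i) - (if k = j then (1 : ℝ) else 0)|
          ≤ lam / τ2 := by
  set A := Z.submatrix id (Subtype.val : {k : Fin p // k ≠ j} → Fin p) with hA
  have hself := lasso_correlation_self A (fun i => Z i j) _ lam hlam.le φhat hmin
  have hcorr := abs_lasso_correlation_le A (fun i => Z i j) _ lam hlam.le φhat hmin
  have hres (i : Fin n) : Z.mulVec Θhat i = (Z i j - A.mulVec φhat i) / τ2 := by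
    simp only [mulVec, dotProduct]
    rw [Fintype.sum_eq_add_sum_subtype_ne _ j, hΘj, sub_div, sum_div, sub_eq_add_neg,
      ← sum_neg_distrib, mul_one_div]
    congr 1
    refine sum_congr rfl fun k _ => ?_
    rw [hΘk k.1 k.2, hA, submatrix_apply, id]
    ring
  have hgram (k : Fin p) : (1 / n : ℝ) * ∑ i, Z i k * Z.mulVec Θhat i
      = ((1 / n : ℝ) * ∑ i, Z i k * (Z i j - A.mulVec φhat i)) / τ2 := by
    simp only [hres, ← mul_div_assoc, ← sum_div]
  have hone : (1 / n : ℝ) * ∑ i, Z i j * Z.mulVec Θhat i = 1 := by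
    rw [hgram, div_eq_one_iff_eq hτpos.ne', hτ2, ← hself, ← mul_add, ← sum_add_distrib]
    congr 1
    refine sum_congr rfl fun i _ => ?_
    ring
  refine ⟨hone, fun k => ?_⟩
  rcases eq_or_ne k j with rfl | hk
  · rw [hone, if_pos rfl, sub_self, abs_zero]
    positivity
  · rw [if_neg hk, sub_zero, hgram, abs_div, abs_of_pos hτpos]
    exact div_le_div_of_nonneg_right (hcorr ⟨k, hk⟩) hτpos.le
end

section
/- Fix α ∈ (0,1), D > 0 and c > 0. There exist constants A > 0 and K > 0, depending only on α, D and c, such that the following holds: for every positive integer n, every C₁ > 0, every probability space with a filtration 𝓕₀ ⊆ 𝓕₁ ⊆ … ⊆ 𝓕_n, and every martingale difference sequence (X_i)_{i=1}^n with respect to (𝓕_i) (i.e., each X_i is 𝓕_i-measurable, integrable, and E[X_i | 𝓕_{i−1}] = 0 almost surely) satisfying sup_{1≤i≤n} E[exp(D·|X_i|^{2α/(1−α)})] ≤ C₁, and every ε ≥ c/√n, one has P(|Σ_{i=1}^n X_i| ≥ n·ε) ≤ A·C₁·exp(−K·(ε²·n)^α). -/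
open MeasureTheory Finset ProbabilityTheory

/-- `(X i)`, `1 ≤ i ≤ n`, is a martingale difference sequence for the filtration `(F i)`,
`0 ≤ i ≤ n`. -/
structure IsMartingaleDiff {Ω : Type*} [m0 : MeasurableSpace Ω] (μ : Measure Ω) (n : ℕ)
    (F : ℕ → MeasurableSpace Ω) (X : ℕ → Ω → ℝ) : Prop where
  mono : ∀ i j, i ≤ j → j ≤ n → F i ≤ F j
  le : ∀ i, i ≤ n → F i ≤ m0
  stronglyMeasurable : ∀ i, 1 ≤ i → i ≤ n → StronglyMeasurable[F i] (X i)
  integrable : ∀ i, 1 ≤ i → i ≤ n → Integrable (X i) μ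
  condExp_eq_zero : ∀ i, 1 ≤ i → i ≤ n → μ[X i | F (i - 1)] =ᵐ[μ] 0

theorem integral_mul_eq_zero_of_condExp_eq_zero {Ω : Type*} {m m0 : MeasurableSpace Ω}
    {μ : Measure Ω} [IsProbabilityMeasure μ] (hm : m ≤ m0) {W Y : Ω → ℝ}
    (hW : StronglyMeasurable[m] W) (hY : Integrable Y μ) (hWY : Integrable (W * Y) μ)
    (h : μ[Y | m] =ᵐ[μ] 0) : ∫ ω, W ω * Y ω ∂μ = 0 := by
  have h1 := condExp_mul_of_stronglyMeasurable_left hW hWY hY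
  have h2 : μ[W * Y | m] =ᵐ[μ] 0 := by
    filter_upwards [h1, h] with ω h1 h2
    simp [h1, h2]
  calc ∫ ω, W ω * Y ω ∂μ = ∫ ω, (μ[W * Y | m]) ω ∂μ := (integral_condExp hm).symm
    _ = 0 := by rw [integral_congr_ae h2]; simp

theorem integral_sq_sub_condExp_le {Ω : Type*} {m m0 : MeasurableSpace Ω}
    {μ : Measure Ω} [IsProbabilityMeasure μ] (hm : m ≤ m0) {T : Ω → ℝ} (hT : MemLp T 2 μ) :
    ∫ ω, (T ω - (μ[T | m]) ω) ^ 2 ∂μ ≤ ∫ ω, T ω ^ 2 ∂μ := by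
  calc ∫ ω, (T ω - (μ[T | m]) ω) ^ 2 ∂μ
      = ∫ ω, (μ[(T - μ[T | m]) ^ 2 | m]) ω ∂μ := (integral_condExp hm).symm
    _ ≤ ∫ ω, (μ[T ^ 2 | m]) ω ∂μ :=
        integral_mono_ae integrable_condExp integrable_condExp (condVar_ae_le_condExp_sq hm hT)
    _ = ∫ ω, T ω ^ 2 ∂μ := integral_condExp hm

/-- The chord bound `exp (l y) ≤ cosh (l b) + (y / b) sinh (l b)` for `|y| ≤ b`. -/
theorem exp_mul_le_cosh_add_sinh {b y l : ℝ} (hb : 0 < b) (hy : |y| ≤ b) :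
    Real.exp (l * y) ≤ Real.cosh (l * b) + Real.sinh (l * b) / b * y := by
  obtain ⟨h1, h2⟩ := abs_le.mp hy
  have hp : 0 ≤ (b + y) / (2 * b) := div_nonneg (by linarith) (by linarith)
  have hq : 0 ≤ (b - y) / (2 * b) := div_nonneg (by linarith) (by linarith)
  have h := convexOn_exp.2 (Set.mem_univ (l * b)) (Set.mem_univ (-(l * b))) hp hq
    (by field_simp; ring)
  simp only [smul_eq_mul] at h
  have e : (b + y) / (2 * b) * (l * b) + (b - y) / (2 * b) * (-(l * b)) = l * y := by
    field_simp
    ring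
  rw [e] at h
  refine h.trans (le_of_eq ?_)
  rw [Real.cosh_eq, Real.sinh_eq]
  field_simp
  ring

namespace IsMartingaleDiff

variable {Ω : Type*} [m0 : MeasurableSpace Ω] {μ : Measure Ω} {n : ℕ}
  {F : ℕ → MeasurableSpace Ω} {X : ℕ → Ω → ℝ}

theorem neg (h : IsMartingaleDiff μ n F X) : IsMartingaleDiff μ n F (fun i ω => -X i ω) where
  mono := h.mono
  le := h.le
  stronglyMeasurable i h1 hn := (h.stronglyMeasurable i h1 hn).neg
  integrable i h1 hn := (h.integrable i h1 hn).neg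
  condExp_eq_zero i h1 hn := by
    have e := condExp_neg (μ := μ) (X i) (F (i - 1))
    filter_upwards [h.condExp_eq_zero i h1 hn, e] with ω h2 h3
    have : (fun ω => -X i ω) = -X i := rfl
    rw [this, h3]; simp [h2]

theorem stronglyMeasurable_sum (h : IsMartingaleDiff μ n F X) {k : ℕ} (hk : k ≤ n) :
    StronglyMeasurable[F k] (fun ω => ∑ i ∈ Icc 1 k, X i ω) := by
  refine Finset.stronglyMeasurable_fun_sum _ fun i hi => ?_
  rw [Finset.mem_Icc] at hi
  exact (h.stronglyMeasurable i hi.1 (hi.2.trans hk)).mono (h.mono i k hi.2 hk)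

theorem sub_condExp [IsProbabilityMeasure μ] (h : IsMartingaleDiff μ n F X) {Y : ℕ → Ω → ℝ}
    (hY : ∀ i, 1 ≤ i → i ≤ n → StronglyMeasurable[F i] (Y i))
    (hYi : ∀ i, 1 ≤ i → i ≤ n → Integrable (Y i) μ) :
    IsMartingaleDiff μ n F (fun i ω => Y i ω - (μ[Y i | F (i - 1)]) ω) where
  mono := h.mono
  le := h.le
  stronglyMeasurable i h1 hn :=
    (hY i h1 hn).sub (stronglyMeasurable_condExp.mono (h.mono (i - 1) i (Nat.sub_le _ _) hn))
  integrable i h1 hn := (hYi i h1 hn).sub integrable_condExp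
  condExp_eq_zero i h1 hn := by
    have hm := h.le (i - 1) (by omega)
    have e1 := condExp_sub (hYi i h1 hn) (integrable_condExp (μ := μ) (m := F (i - 1)) (f := Y i))
      (F (i - 1))
    have e2 : μ[μ[Y i | F (i - 1)] | F (i - 1)] = μ[Y i | F (i - 1)] :=
      condExp_of_stronglyMeasurable hm stronglyMeasurable_condExp integrable_condExp
    filter_upwards [e1] with ω e1
    change (μ[Y i - μ[Y i | F (i - 1)] | F (i - 1)]) ω = 0
    rw [e1, Pi.sub_apply, e2, sub_self]

theorem sub [IsProbabilityMeasure μ] (h : IsMartingaleDiff μ n F X) {Y : ℕ → Ω → ℝ}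
    (hY : IsMartingaleDiff μ n F Y) : IsMartingaleDiff μ n F (fun i ω => X i ω - Y i ω) where
  mono := h.mono
  le := h.le
  stronglyMeasurable i h1 hn := (h.stronglyMeasurable i h1 hn).sub (hY.stronglyMeasurable i h1 hn)
  integrable i h1 hn := (h.integrable i h1 hn).sub (hY.integrable i h1 hn)
  condExp_eq_zero i h1 hn := by
    filter_upwards [condExp_sub (h.integrable i h1 hn) (hY.integrable i h1 hn) (F (i - 1)),
      h.condExp_eq_zero i h1 hn, hY.condExp_eq_zero i h1 hn] with ω e1 e2 e3
    change (μ[X i - Y i | F (i - 1)]) ω = 0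
    rw [e1, Pi.sub_apply, e2, e3]; simp

theorem integral_exp_sum_le [IsProbabilityMeasure μ] (h : IsMartingaleDiff μ n F X) {b : ℝ}
    (hb : 0 < b) (hX : ∀ i, 1 ≤ i → i ≤ n → ∀ᵐ ω ∂μ, |X i ω| ≤ b) (l : ℝ) {k : ℕ} (hk : k ≤ n) :
    Integrable (fun ω => Real.exp (l * ∑ i ∈ Icc 1 k, X i ω)) μ ∧
      ∫ ω, Real.exp (l * ∑ i ∈ Icc 1 k, X i ω) ∂μ ≤ Real.exp (k * ((l * b) ^ 2 / 2)) := by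
  induction k with
  | zero => simp
  | succ k ih =>
    obtain ⟨ihi, ih⟩ := ih (by omega)
    have hbd := hX (k + 1) (by omega) hk
    have hmk : AEStronglyMeasurable (X (k + 1)) μ :=
      ((h.stronglyMeasurable (k + 1) (by omega) hk).mono (h.le _ hk)).aestronglyMeasurable
    set W : Ω → ℝ := fun ω => Real.exp (l * ∑ i ∈ Icc 1 k, X i ω) with hW
    have hWm : StronglyMeasurable[F k] W :=
      Real.continuous_exp.comp_stronglyMeasurable
        ((h.stronglyMeasurable_sum (by omega : k ≤ n)).const_mul l)
    have hWX : Integrable (fun ω => W ω * X (k + 1) ω) μ := ihi.mul_bdd hmk hbd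
    have hzero : ∫ ω, W ω * X (k + 1) ω ∂μ = 0 :=
      integral_mul_eq_zero_of_condExp_eq_zero (h.le k (by omega)) hWm
        (h.integrable (k + 1) (by omega) hk) hWX (h.condExp_eq_zero (k + 1) (by omega) hk)
    have hsplit : ∀ ω, Real.exp (l * ∑ i ∈ Icc 1 (k + 1), X i ω)
        = W ω * Real.exp (l * X (k + 1) ω) := by
      intro ω
      rw [Finset.sum_Icc_succ_top (by omega), mul_add, Real.exp_add]
    simp_rw [hsplit]
    have hint : Integrable (fun ω => W ω * Real.exp (l * X (k + 1) ω)) μ := by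
      refine ihi.mul_bdd (c := Real.exp (|l| * b))
        (Real.continuous_exp.comp_aestronglyMeasurable (hmk.const_mul l)) ?_
      filter_upwards [hbd] with ω hω
      rw [Real.norm_eq_abs, Real.abs_exp]
      refine Real.exp_le_exp.mpr ((le_abs_self _).trans ?_)
      rw [abs_mul]
      gcongr
    refine ⟨hint, ?_⟩
    set s := Real.sinh (l * b) / b
    calc ∫ ω, W ω * Real.exp (l * X (k + 1) ω) ∂μ
        ≤ ∫ ω, (Real.cosh (l * b) * W ω + s * (W ω * X (k + 1) ω)) ∂μ := by
          refine integral_mono_ae hint ((ihi.const_mul _).add (hWX.const_mul _)) ?_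
          filter_upwards [hbd] with ω hω
          have := mul_le_mul_of_nonneg_left (exp_mul_le_cosh_add_sinh (l := l) hb hω)
            (Real.exp_pos (l * ∑ i ∈ Icc 1 k, X i ω)).le
          calc _ ≤ _ := this
            _ = _ := by simp only [hW, s]; ring
      _ = Real.cosh (l * b) * ∫ ω, W ω ∂μ := by
          rw [integral_add (ihi.const_mul _) (hWX.const_mul _), integral_const_mul,
            integral_const_mul, hzero, mul_zero, add_zero]
      _ ≤ Real.exp ((l * b) ^ 2 / 2) * Real.exp (k * ((l * b) ^ 2 / 2)) := by
          gcongr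
          exact Real.cosh_le_exp_half_sq _
      _ = Real.exp ((k + 1 : ℕ) * ((l * b) ^ 2 / 2)) := by
          rw [← Real.exp_add]; push_cast; ring_nf

/-- One-sided **Azuma–Hoeffding inequality**. -/
theorem measureReal_le_sum_le [IsProbabilityMeasure μ] (h : IsMartingaleDiff μ n F X) (hn : 0 < n)
    {b : ℝ} (hb : 0 < b) (hX : ∀ i, 1 ≤ i → i ≤ n → ∀ᵐ ω ∂μ, |X i ω| ≤ b) {t : ℝ} (ht : 0 ≤ t) :
    μ.real {ω | t ≤ ∑ i ∈ Icc 1 n, X i ω} ≤ Real.exp (-(t ^ 2 / (2 * n * b ^ 2))) := by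
  have hn' : (0 : ℝ) < n := by exact_mod_cast hn
  set l := t / (n * b ^ 2) with hl
  obtain ⟨hi, hle⟩ := h.integral_exp_sum_le hb hX l le_rfl
  refine (measure_ge_le_exp_mul_mgf (X := fun ω => ∑ i ∈ Icc 1 n, X i ω) t
    (by positivity : 0 ≤ l) hi).trans ?_
  calc _ ≤ Real.exp (-l * t) * Real.exp (n * ((l * b) ^ 2 / 2)) := by
        gcongr
        exact hle
    _ = _ := by
        rw [← Real.exp_add, hl]
        congr 1
        field_simp
        ring

/-- **Azuma–Hoeffding inequality**. -/
theorem measureReal_le_abs_sum_le [IsProbabilityMeasure μ] (h : IsMartingaleDiff μ n F X)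
    (hn : 0 < n) {b : ℝ} (hb : 0 < b) (hX : ∀ i, 1 ≤ i → i ≤ n → ∀ᵐ ω ∂μ, |X i ω| ≤ b)
    {t : ℝ} (ht : 0 ≤ t) :
    μ.real {ω | t ≤ |∑ i ∈ Icc 1 n, X i ω|} ≤ 2 * Real.exp (-(t ^ 2 / (2 * n * b ^ 2))) := by
  have h1 := h.measureReal_le_sum_le hn hb hX ht
  have h2 := h.neg.measureReal_le_sum_le hn hb (by simpa only [abs_neg] using hX) ht
  have hsub : {ω | t ≤ |∑ i ∈ Icc 1 n, X i ω|} ⊆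
      {ω | t ≤ ∑ i ∈ Icc 1 n, X i ω} ∪ {ω | t ≤ ∑ i ∈ Icc 1 n, -X i ω} := by
    intro ω hω
    simpa [le_abs] using hω
  have h3 := (measureReal_mono (μ := μ) hsub).trans (measureReal_union_le _ _)
  linarith

theorem integral_sq_sum_le [IsProbabilityMeasure μ] (h : IsMartingaleDiff μ n F X) {v : ℝ}
    (hX : ∀ i, 1 ≤ i → i ≤ n → MemLp (X i) 2 μ)
    (hv : ∀ i, 1 ≤ i → i ≤ n → ∫ ω, X i ω ^ 2 ∂μ ≤ v) {k : ℕ} (hk : k ≤ n) :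
    MemLp (fun ω => ∑ i ∈ Icc 1 k, X i ω) 2 μ ∧
      ∫ ω, (∑ i ∈ Icc 1 k, X i ω) ^ 2 ∂μ ≤ k * v := by
  induction k with
  | zero => simp
  | succ k ih =>
    obtain ⟨ihi, ih⟩ := ih (by omega)
    have hL := hX (k + 1) (by omega) hk
    set W : Ω → ℝ := fun ω => ∑ i ∈ Icc 1 k, X i ω with hW
    have hWX : Integrable (W * X (k + 1)) μ := ihi.integrable_mul hL
    have hzero : ∫ ω, W ω * X (k + 1) ω ∂μ = 0 :=
      integral_mul_eq_zero_of_condExp_eq_zero (h.le k (by omega))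
        (h.stronglyMeasurable_sum (by omega : k ≤ n))
        (h.integrable (k + 1) (by omega) hk) hWX (h.condExp_eq_zero (k + 1) (by omega) hk)
    have hsplit : ∀ ω, ∑ i ∈ Icc 1 (k + 1), X i ω = W ω + X (k + 1) ω := fun ω =>
      Finset.sum_Icc_succ_top (by omega) _
    simp_rw [hsplit]
    refine ⟨ihi.add hL, ?_⟩
    have hexp : ∀ ω, (W ω + X (k + 1) ω) ^ 2
        = W ω ^ 2 + 2 * (W ω * X (k + 1) ω) + X (k + 1) ω ^ 2 := fun ω => by ring
    simp_rw [hexp]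
    have hWX2 : Integrable (fun ω => 2 * (W ω * X (k + 1) ω)) μ := hWX.const_mul 2
    have hsum : Integrable (fun ω => W ω ^ 2 + 2 * (W ω * X (k + 1) ω)) μ :=
      ihi.integrable_sq.add hWX2
    rw [integral_add hsum hL.integrable_sq,
      integral_add ihi.integrable_sq hWX2, integral_const_mul, hzero]
    have := hv (k + 1) (by omega) hk
    push_cast
    linarith

/-- **Chebyshev's inequality** for martingales with square-integrable differences. -/
theorem sq_mul_measureReal_le [IsProbabilityMeasure μ] (h : IsMartingaleDiff μ n F X) {v : ℝ}
    (hX : ∀ i, 1 ≤ i → i ≤ n → MemLp (X i) 2 μ)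
    (hv : ∀ i, 1 ≤ i → i ≤ n → ∫ ω, X i ω ^ 2 ∂μ ≤ v) {t : ℝ} (ht : 0 ≤ t) :
    t ^ 2 * μ.real {ω | t ≤ |∑ i ∈ Icc 1 n, X i ω|} ≤ n * v := by
  obtain ⟨hi, hle⟩ := h.integral_sq_sum_le hX hv le_rfl
  have hset : {ω | t ≤ |∑ i ∈ Icc 1 n, X i ω|} = {ω | t ^ 2 ≤ (∑ i ∈ Icc 1 n, X i ω) ^ 2} := by
    ext ω
    simp [sq_le_sq, abs_of_nonneg ht]
  rw [hset]
  exact (mul_meas_ge_le_integral_of_nonneg (Filter.Eventually.of_forall fun ω => sq_nonneg _)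
    hi.integrable_sq _).trans hle

/-- Concentration by truncation at level `u`: the truncated part is handled by Azuma–Hoeffding,
the remainder by Chebyshev. -/
theorem measureReal_le_abs_sum_le_of_truncation [IsProbabilityMeasure μ]
    (h : IsMartingaleDiff μ n F X) (hn : 0 < n) {u v t : ℝ} (hu : 0 < u) (ht : 0 < t)
    (hX : ∀ i, 1 ≤ i → i ≤ n → MemLp (X i) 2 μ)
    (hv : ∀ i, 1 ≤ i → i ≤ n → ∫ ω, (if |X i ω| ≤ u then 0 else X i ω) ^ 2 ∂μ ≤ v) :
    μ.real {ω | t ≤ |∑ i ∈ Icc 1 n, X i ω|} ≤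
      2 * Real.exp (-(t ^ 2 / (32 * n * u ^ 2))) + 4 * n * v / t ^ 2 := by
  set B : ℕ → Ω → ℝ := fun i ω => if |X i ω| ≤ u then X i ω else 0 with hB
  set T : ℕ → Ω → ℝ := fun i ω => if |X i ω| ≤ u then 0 else X i ω with hT
  have hgm : Measurable (fun x : ℝ => if |x| ≤ u then x else 0) :=
    Measurable.ite (measurableSet_le (by fun_prop) measurable_const) measurable_id measurable_const
  have hBm : ∀ i, 1 ≤ i → i ≤ n → StronglyMeasurable[F i] (B i) := fun i h1 h2 =>
    (hgm.comp (h.stronglyMeasurable i h1 h2).measurable).stronglyMeasurable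
  have hBb : ∀ i ω, |B i ω| ≤ u := by
    intro i ω
    simp only [hB]
    split_ifs with hc
    · exact hc
    · simpa using hu.le
  have hBL : ∀ i, 1 ≤ i → i ≤ n → MemLp (B i) 2 μ := fun i h1 h2 =>
    MemLp.of_bound ((hBm i h1 h2).mono (h.le i h2)).aestronglyMeasurable u
      (Filter.Eventually.of_forall (hBb i))
  have hTB : ∀ i, T i = X i - B i := by
    intro i
    ext ω
    simp only [hT, hB, Pi.sub_apply]
    split_ifs <;> simp
  have hTL : ∀ i, 1 ≤ i → i ≤ n → MemLp (T i) 2 μ := fun i h1 h2 => by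
    rw [hTB]; exact (hX i h1 h2).sub (hBL i h1 h2)
  have hBi : ∀ i, 1 ≤ i → i ≤ n → Integrable (B i) μ := fun i h1 h2 =>
    (hBL i h1 h2).integrable one_le_two
  have hY := h.sub_condExp hBm hBi
  have hZ := h.sub hY
  set Y : ℕ → Ω → ℝ := fun i ω => B i ω - (μ[B i | F (i - 1)]) ω with hYdef
  have hYb : ∀ i, 1 ≤ i → i ≤ n → ∀ᵐ ω ∂μ, |Y i ω| ≤ 2 * u := by
    intro i h1 h2
    have := ae_bdd_abs_condExp_of_ae_bdd_abs (μ := μ) (m := F (i - 1)) (f := B i)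
      (Filter.Eventually.of_forall (hBb i))
    filter_upwards [this] with ω hω
    have := abs_sub (B i ω) ((μ[B i | F (i - 1)]) ω)
    have := hBb i ω
    simp only [hYdef]
    linarith
  have hZae : ∀ i, 1 ≤ i → i ≤ n →
      (fun ω => X i ω - Y i ω) =ᵐ[μ] fun ω => T i ω - (μ[T i | F (i - 1)]) ω := by
    intro i h1 h2
    rw [hTB]
    filter_upwards [condExp_sub (h.integrable i h1 h2) (hBi i h1 h2) (F (i - 1)),
      h.condExp_eq_zero i h1 h2] with ω e1 e2
    rw [e1]
    simp [e2, hYdef]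
    ring
  have hZL : ∀ i, 1 ≤ i → i ≤ n → MemLp (fun ω => X i ω - Y i ω) 2 μ := fun i h1 h2 =>
    (memLp_congr_ae (hZae i h1 h2)).mpr ((hTL i h1 h2).sub ((hTL i h1 h2).condExp one_le_two))
  have hZv : ∀ i, 1 ≤ i → i ≤ n → ∫ ω, (X i ω - Y i ω) ^ 2 ∂μ ≤ v := by
    intro i h1 h2
    have : (fun ω => (X i ω - Y i ω) ^ 2) =ᵐ[μ]
        fun ω => (T i ω - (μ[T i | F (i - 1)]) ω) ^ 2 := by
      filter_upwards [hZae i h1 h2] with ω hω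
      rw [hω]
    rw [integral_congr_ae this]
    exact (integral_sq_sub_condExp_le (h.le (i - 1) (by omega)) (hTL i h1 h2)).trans (hv i h1 h2)
  have b1 := hY.measureReal_le_abs_sum_le hn (by positivity : 0 < 2 * u) hYb
    (by positivity : 0 ≤ t / 2)
  have b2 := hZ.sq_mul_measureReal_le hZL hZv (by positivity : 0 ≤ t / 2)
  have hsub : {ω | t ≤ |∑ i ∈ Icc 1 n, X i ω|} ⊆
      {ω | t / 2 ≤ |∑ i ∈ Icc 1 n, Y i ω|} ∪ {ω | t / 2 ≤ |∑ i ∈ Icc 1 n, (X i ω - Y i ω)|} := by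
    intro ω hω
    simp only [Set.mem_ofPred_eq, Set.mem_union] at hω ⊢
    by_contra! hcon
    obtain ⟨hc1, hc2⟩ := hcon
    rw [Finset.sum_sub_distrib (fun i => X i ω) (fun i => Y i ω)] at hc2
    have := abs_add_le (∑ i ∈ Icc 1 n, Y i ω) (∑ i ∈ Icc 1 n, X i ω - ∑ i ∈ Icc 1 n, Y i ω)
    rw [add_sub_cancel] at this
    linarith
  refine (measureReal_mono hsub).trans ((measureReal_union_le _ _).trans (add_le_add ?_ ?_))
  · refine b1.trans (le_of_eq ?_)
    congr 3
    have : (n : ℝ) ≠ 0 := by exact_mod_cast hn.ne'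
    field_simp
    ring
  · rw [le_div_iff₀ (by positivity)]
    linarith

end IsMartingaleDiff

theorem exists_sq_le_mul_exp_rpow {p a : ℝ} (hp : 0 < p) (ha : 0 < a) :
    ∃ M : ℝ, 0 < M ∧ ∀ y : ℝ, 0 ≤ y → y ^ 2 ≤ M * Real.exp (a * y ^ p) := by
  obtain ⟨N, hN⟩ := exists_nat_ge (2 / p)
  refine ⟨1 + N.factorial / a ^ N, by positivity, fun y hy => ?_⟩
  have hyp : 0 ≤ y ^ p := Real.rpow_nonneg hy p
  have hE : 1 ≤ Real.exp (a * y ^ p) := Real.one_le_exp (by positivity)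
  have hfac : (y ^ p) ^ N ≤ N.factorial / a ^ N * Real.exp (a * y ^ p) := by
    have := Real.pow_div_factorial_le_exp (x := a * y ^ p) (by positivity) N
    rw [mul_pow, div_le_iff₀ (by positivity)] at this
    rw [div_mul_eq_mul_div, le_div_iff₀ (by positivity)]
    linarith
  rcases le_total y 1 with h1 | h1
  · have : y ^ 2 ≤ 1 := pow_le_one₀ hy h1
    have : 0 ≤ N.factorial / a ^ N * Real.exp (a * y ^ p) := by positivity
    linarith
  · have : y ^ 2 ≤ (y ^ p) ^ N := by
      rw [← Real.rpow_mul_natCast hy, ← Real.rpow_natCast y 2]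
      refine Real.rpow_le_rpow_of_exponent_le h1 ?_
      rw [div_le_iff₀ hp] at hN
      push_cast
      linarith
    linarith

theorem sq_tail_le_mul_exp_rpow {p D M : ℝ} (hp : 0 < p) (hD : 0 < D) (hM : 0 < M)
    (h : ∀ y : ℝ, 0 ≤ y → y ^ 2 ≤ M * Real.exp (D / 2 * y ^ p)) {u : ℝ} (hu : 0 < u) (x : ℝ) :
    (if |x| ≤ u then 0 else x) ^ 2
      ≤ M * Real.exp (-(D / 2 * u ^ p)) * Real.exp (D * |x| ^ p) := by
  split_ifs with hc
  · rw [zero_pow two_ne_zero]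
    positivity
  · push Not at hc
    have h1 := h |x| (abs_nonneg x)
    rw [sq_abs] at h1
    refine h1.trans ?_
    rw [mul_assoc, ← Real.exp_add]
    have := Real.rpow_le_rpow hu.le hc.le hp.le
    gcongr
    nlinarith

theorem IsMartingaleDiff.measureReal_le_abs_sum_le_of_exp_moment {Ω : Type*}
    [MeasurableSpace Ω] {μ : Measure Ω} [IsProbabilityMeasure μ] {n : ℕ}
    {F : ℕ → MeasurableSpace Ω} {X : ℕ → Ω → ℝ} (h : IsMartingaleDiff μ n F X) (hn : 0 < n)
    {p D M C : ℝ} (hp : 0 < p) (hD : 0 < D) (hM : 0 < M)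
    (hMexp : ∀ y : ℝ, 0 ≤ y → y ^ 2 ≤ M * Real.exp (D / 2 * y ^ p))
    (hXi : ∀ i, 1 ≤ i → i ≤ n → Integrable (fun ω => Real.exp (D * |X i ω| ^ p)) μ)
    (hXC : ∀ i, 1 ≤ i → i ≤ n → ∫ ω, Real.exp (D * |X i ω| ^ p) ∂μ ≤ C)
    {u t : ℝ} (hu : 0 < u) (ht : 0 < t) :
    μ.real {ω | t ≤ |∑ i ∈ Icc 1 n, X i ω|} ≤
      2 * Real.exp (-(t ^ 2 / (32 * n * u ^ 2))) +
        4 * n * (M * Real.exp (-(D / 2 * u ^ p)) * C) / t ^ 2 := by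
  have hXm : ∀ i, 1 ≤ i → i ≤ n → AEStronglyMeasurable (X i) μ := fun i h1 h2 =>
    (h.integrable i h1 h2).aestronglyMeasurable
  refine h.measureReal_le_abs_sum_le_of_truncation hn hu ht (fun i h1 h2 => ?_) fun i h1 h2 => ?_
  · rw [memLp_two_iff_integrable_sq (hXm i h1 h2)]
    refine ((hXi i h1 h2).const_mul M).mono' ((hXm i h1 h2).pow 2)
      (Filter.Eventually.of_forall fun ω => ?_)
    rw [Real.norm_eq_abs, abs_of_nonneg (sq_nonneg _), ← sq_abs]
    refine (hMexp _ (abs_nonneg _)).trans ?_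
    have := Real.rpow_nonneg (abs_nonneg (X i ω)) p
    gcongr
    linarith
  · calc _ ≤ ∫ ω, M * Real.exp (-(D / 2 * u ^ p)) * Real.exp (D * |X i ω| ^ p) ∂μ :=
          integral_mono_of_nonneg (Filter.Eventually.of_forall fun ω => sq_nonneg _)
            ((hXi i h1 h2).const_mul _) (Filter.Eventually.of_forall fun ω =>
              sq_tail_le_mul_exp_rpow hp hD hM hMexp hu (X i ω))
      _ ≤ _ := by
          rw [integral_const_mul]
          gcongr
          exact hXC i h1 h2

/-- Proposition adapted from Fan, Grama & Liu: a concentration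
inequality for martingale difference sequences with uniformly bounded exponential
Orlicz-type moments.  The constants `A` and `K` depend only on `α`, `D` and `c`. -/
theorem stmt12
    (α D c : ℝ) (hα0 : 0 < α) (hα1 : α < 1) (hD : 0 < D) (hc : 0 < c) :
    ∃ A K : ℝ, 0 < A ∧ 0 < K ∧
      ∀ (n : ℕ), 0 < n →
      ∀ (C₁ : ℝ), 0 < C₁ →
      ∀ (Ω : Type) (m0 : MeasurableSpace Ω) (μ : @MeasureTheory.Measure Ω m0),
        IsProbabilityMeasure μ →
      ∀ F : ℕ → MeasurableSpace Ω,
        -- a filtration `𝓕₀ ⊆ 𝓕₁ ⊆ … ⊆ 𝓕_n` of sub-σ-algebras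
        (∀ i j, i ≤ j → j ≤ n → F i ≤ F j) →
        (∀ i, i ≤ n → F i ≤ m0) →
      ∀ X : ℕ → Ω → ℝ,
        -- `(X_i)_{i=1}^n` is a martingale difference sequence w.r.t. `(𝓕_i)`
        (∀ i, 1 ≤ i → i ≤ n → @Measurable Ω ℝ (F i) _ (X i)) →
        (∀ i, 1 ≤ i → i ≤ n → Integrable (X i) μ) →
        (∀ i, 1 ≤ i → i ≤ n → μ[X i | F (i - 1)] =ᵐ[μ] 0) →
        -- uniformly bounded exponential moments
        (∀ i, 1 ≤ i → i ≤ n →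
          (∫⁻ ω, ENNReal.ofReal (Real.exp (D * |X i ω| ^ (2 * α / (1 - α)))) ∂μ)
            ≤ ENNReal.ofReal C₁) →
      ∀ ε : ℝ, c / Real.sqrt n ≤ ε →
        μ {ω | (n : ℝ) * ε ≤ |∑ i ∈ Finset.Icc 1 n, X i ω|}
          ≤ ENNReal.ofReal (A * C₁ * Real.exp (-K * (ε ^ 2 * n) ^ α)) := by
  set p := 2 * α / (1 - α) with hp_def
  have h1α : 0 < 1 - α := by linarith
  have hp : 0 < p := by positivity
  obtain ⟨M, hM, hMexp⟩ := exists_sq_le_mul_exp_rpow hp (by positivity : 0 < D / 2)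
  refine ⟨2 + 4 * M / c ^ 2, min (1 / 32) (D / 2), by positivity, by positivity, ?_⟩
  intro n hn C₁ hC₁ Ω m0 μ hμ F hmono hle X hXm hXint hXce hXexp ε hε
  have hn' : (0 : ℝ) < n := by exact_mod_cast hn
  have hMD : IsMartingaleDiff μ n F X :=
    ⟨hmono, hle, fun i h1 h2 => (hXm i h1 h2).stronglyMeasurable, hXint, hXce⟩
  have hEm : ∀ i, 1 ≤ i → i ≤ n →
      AEStronglyMeasurable (fun ω => Real.exp (D * |X i ω| ^ p)) μ := by
    intro i h1 h2
    have hm : Measurable (X i) := (hXm i h1 h2).mono (hle i h2) le_rfl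
    have : Measurable (fun ω => Real.exp (D * |X i ω| ^ p)) := by fun_prop
    exact this.aestronglyMeasurable
  have hEi : ∀ i, 1 ≤ i → i ≤ n → Integrable (fun ω => Real.exp (D * |X i ω| ^ p)) μ :=
    fun i h1 h2 => (lintegral_ofReal_ne_top_iff_integrable (hEm i h1 h2)
      (Filter.Eventually.of_forall fun ω => (Real.exp_pos _).le)).mp
      (ne_top_of_le_ne_top ENNReal.ofReal_ne_top (hXexp i h1 h2))
  have hEC : ∀ i, 1 ≤ i → i ≤ n → ∫ ω, Real.exp (D * |X i ω| ^ p) ∂μ ≤ C₁ := by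
    intro i h1 h2
    have := hXexp i h1 h2
    rw [← ofReal_integral_eq_lintegral_ofReal (hEi i h1 h2)
      (Filter.Eventually.of_forall fun ω => (Real.exp_pos _).le)] at this
    exact (ENNReal.ofReal_le_ofReal_iff hC₁.le).mp this
  have hC1 : 1 ≤ C₁ := by
    refine le_trans ?_ (hEC 1 le_rfl hn)
    calc (1 : ℝ) = ∫ _, (1 : ℝ) ∂μ := by simp
      _ ≤ _ := integral_mono (integrable_const _) (hEi 1 le_rfl hn) fun ω =>
        Real.one_le_exp (by positivity)
  have hε0 : 0 < ε := lt_of_lt_of_le (by positivity) hε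
  have hcx : c ^ 2 ≤ ε ^ 2 * n := by
    rw [div_le_iff₀ (by positivity)] at hε
    calc c ^ 2 ≤ (ε * Real.sqrt n) ^ 2 := by gcongr
      _ = ε ^ 2 * n := by rw [mul_pow, Real.sq_sqrt hn'.le]
  set q := ε ^ 2 * n with hq
  have hq0 : 0 < q := by positivity
  set u := q ^ ((1 - α) / 2) with hu
  have hu0 : 0 < u := Real.rpow_pos_of_pos hq0 _
  have hup : u ^ p = q ^ α := by
    rw [hu, ← Real.rpow_mul hq0.le]
    congr 1
    rw [hp_def]
    field_simp
  have hu2 : q / u ^ 2 = q ^ α := by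
    rw [hu, ← Real.rpow_mul_natCast hq0.le, div_eq_iff (by positivity), ← Real.rpow_add hq0]
    conv_lhs => rw [← Real.rpow_one q]
    congr 1
    push_cast
    ring
  have key := hMD.measureReal_le_abs_sum_le_of_exp_moment hn hp hD hM hMexp hEi hEC hu0
    (by positivity : 0 < (n : ℝ) * ε)
  have e1 : ((n : ℝ) * ε) ^ 2 / (32 * n * u ^ 2) = 1 / 32 * q ^ α := by
    rw [← hu2, hq]
    field_simp
  rw [e1, hup] at key
  rw [← ofReal_measureReal]
  refine ENNReal.ofReal_le_ofReal (key.trans ?_)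
  set K := min (1 / 32 : ℝ) (D / 2) with hK
  have hqα : 0 < q ^ α := Real.rpow_pos_of_pos hq0 _
  have f1 : Real.exp (-(1 / 32 * q ^ α)) ≤ Real.exp (-K * q ^ α) := by
    have : K ≤ 1 / 32 := min_le_left _ _
    apply Real.exp_le_exp.mpr
    nlinarith
  have f2 : Real.exp (-(D / 2 * q ^ α)) ≤ Real.exp (-K * q ^ α) := by
    have : K ≤ D / 2 := min_le_right _ _
    apply Real.exp_le_exp.mpr
    nlinarith
  have e2 : 4 * n * (M * Real.exp (-(D / 2 * q ^ α)) * C₁) / ((n : ℝ) * ε) ^ 2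
      = 4 * M * C₁ / q * Real.exp (-(D / 2 * q ^ α)) := by
    generalize Real.exp (-(D / 2 * q ^ α)) = E
    rw [hq]
    field_simp
  rw [e2]
  set E := Real.exp (-K * q ^ α) with hE
  have hE0 : 0 < E := Real.exp_pos _
  calc 2 * Real.exp (-(1 / 32 * q ^ α)) + 4 * M * C₁ / q * Real.exp (-(D / 2 * q ^ α))
      ≤ 2 * C₁ * E + 4 * M * C₁ / c ^ 2 * E := by
        gcongr
        linarith
    _ = (2 + 4 * M / c ^ 2) * C₁ * E := by ring
end

section
/- Let L ≥ 1 be an integer and K, C > 0. Let Z₁, …, Z_L be real random variables on a common probability space such that for each l and every ε ≥ 0, P(|Z_l| ≥ ε) ≤ (K/2)·e^{−Cε²}. Then E[∏_{l=1}^L |Z_l|] ≤ (L!)^L · ((1 + K/2)/(C·log 2))^{L/2}. -/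
open MeasureTheory Finset

/-- The squared product of `L` real numbers is at most the average of their `2L`-th powers. -/
lemma sq_prod_abs_le_inv_mul_sum {L : ℕ} (hL : L ≠ 0) (a : Fin L → ℝ) :
    (∏ l, |a l|) ^ 2 ≤ (L : ℝ)⁻¹ * ∑ l, (a l ^ 2) ^ L := by
  have hL0 : (0 : ℝ) < L := by positivity
  have h := Real.geom_mean_le_arith_mean_weighted univ (fun _ : Fin L => (L : ℝ)⁻¹)
    (fun l => (a l ^ 2) ^ L) (fun _ _ => by positivity) (by simp [hL0.ne'])
    (fun _ _ => by positivity)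
  rw [← Finset.mul_sum] at h
  refine le_of_eq_of_le ?_ h
  rw [← Finset.prod_pow]
  refine Finset.prod_congr rfl fun l _ => ?_
  rw [Real.pow_rpow_inv_natCast (sq_nonneg _) hL, sq_abs]

/-- A nonnegative variable with an exponential tail has moments bounded by those of the
exponential distribution. -/
lemma lintegral_pow_le_of_exp_tail {Ω : Type*} [MeasurableSpace Ω] {μ : Measure Ω}
    {X : Ω → ℝ} (hX : Measurable X) (hX0 : ∀ ω, 0 ≤ X ω) {A C : ℝ} (hA : 0 ≤ A) (hC : 0 < C)
    (htail : ∀ t : ℝ, 0 ≤ t → μ {ω | t ≤ X ω} ≤ ENNReal.ofReal (A * Real.exp (-C * t)))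
    {n : ℕ} (hn : n ≠ 0) :
    ∫⁻ ω, ENNReal.ofReal (X ω ^ n) ∂μ ≤ ENNReal.ofReal (A * n.factorial / C ^ n) := by
  have hn0 : (0 : ℝ) < n := by positivity
  have hlayer := lintegral_rpow_eq_lintegral_meas_le_mul μ
    (Filter.Eventually.of_forall hX0) hX.aemeasurable hn0
  simp only [Real.rpow_natCast] at hlayer
  have hint : IntegrableOn (fun t : ℝ => t ^ ((n : ℝ) - 1) * Real.exp (-(C * t))) (Set.Ioi 0) := by
    have := integrableOn_rpow_mul_exp_neg_mul_rpow (s := (n : ℝ) - 1) (p := 1) (b := C)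
      (by linarith) one_pos hC
    simpa [neg_mul] using this
  have hval := Real.integral_rpow_mul_exp_neg_mul_Ioi hn0 hC
  have hgamma : (n : ℝ) * Real.Gamma n = n.factorial := by
    rw [← Real.Gamma_add_one hn0.ne', Real.Gamma_nat_eq_factorial]
  rw [hlayer]
  calc ENNReal.ofReal n * ∫⁻ t in Set.Ioi 0, μ {ω | t ≤ X ω} * ENNReal.ofReal (t ^ ((n : ℝ) - 1))
      ≤ ENNReal.ofReal n * ∫⁻ t in Set.Ioi 0,
          ENNReal.ofReal A * ENNReal.ofReal (t ^ ((n : ℝ) - 1) * Real.exp (-(C * t))) := by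
        gcongr ENNReal.ofReal n * ?_
        refine setLIntegral_mono' measurableSet_Ioi fun t ht => ?_
        have ht0 : (0 : ℝ) < t := ht
        calc _ ≤ ENNReal.ofReal (A * Real.exp (-C * t)) * ENNReal.ofReal (t ^ ((n : ℝ) - 1)) := by
              gcongr
              exact htail t ht0.le
          _ = _ := by
              rw [← ENNReal.ofReal_mul (by positivity), ← ENNReal.ofReal_mul hA]
              congr 1
              ring_nf
    _ = ENNReal.ofReal (A * n.factorial / C ^ n) := by
        rw [lintegral_const_mul' _ _ ENNReal.ofReal_ne_top,
          ← ofReal_integral_eq_lintegral_ofReal hint, hval, ← ENNReal.ofReal_mul hA,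
          ← ENNReal.ofReal_mul hn0.le, ← hgamma, Real.rpow_natCast]
        · congr 1
          rw [one_div, inv_pow]
          ring
        · filter_upwards [ae_restrict_mem measurableSet_Ioi] with t ht
          have ht0 : (0 : ℝ) < t := ht
          positivity

/-- if `Z₁, …, Z_L` are real random variables with subgaussian tails
`P(|Z_l| ≥ ε) ≤ (K/2)e^{−Cε²}`, then
`E[∏_l |Z_l|] ≤ (L!)^L · ((1 + K/2)/(C·log 2))^{L/2}`. -/
theorem stmt13
    (L : ℕ) (hL : 1 ≤ L) (K C : ℝ) (hK : 0 < K) (hC : 0 < C)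
    (Ω : Type) [MeasurableSpace Ω] (μ : Measure Ω) [IsProbabilityMeasure μ]
    (Z : Fin L → Ω → ℝ) (hmeas : ∀ l, Measurable (Z l))
    (htail : ∀ l, ∀ ε : ℝ, 0 ≤ ε →
      μ {ω | ε ≤ |Z l ω|} ≤ ENNReal.ofReal (K / 2 * Real.exp (-C * ε ^ 2))) :
    (∫⁻ ω, ENNReal.ofReal (∏ l, |Z l ω|) ∂μ)
      ≤ ENNReal.ofReal ((Nat.factorial L : ℝ) ^ L
          * ((1 + K / 2) / (C * Real.log 2)) ^ ((L : ℝ) / 2)) := by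
  have hL0 : L ≠ 0 := by omega
  have hLpos : (0 : ℝ) < L := by positivity
  have hlog : 0 < Real.log 2 := Real.log_pos one_lt_two
  have hlog1 : Real.log 2 ≤ 1 := by linarith [Real.log_two_lt_d9]
  set T : ℝ := (Nat.factorial L : ℝ) ^ L
    * ((1 + K / 2) / (C * Real.log 2)) ^ ((L : ℝ) / 2) with hT
  have hTpos : 0 < T := by positivity
  set M : ℝ := K / 2 * L.factorial / C ^ L with hM
  have hMpos : 0 < M := by positivity
  have hTsq : T ^ 2 = ((Nat.factorial L : ℝ) ^ L) ^ 2 * ((1 + K / 2) / (C * Real.log 2)) ^ L := by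
    rw [hT, mul_pow, ← Real.rpow_mul_natCast (by positivity)]
    norm_num
  have hMT : M ≤ T ^ 2 := by
    have hfac : (1 : ℝ) ≤ L.factorial := by exact_mod_cast L.factorial_pos
    have h₁ : (L.factorial : ℝ) ≤ (L.factorial ^ L) ^ 2 := by
      rw [← pow_mul]
      exact le_self_pow₀ hfac (by omega)
    have h₂ : K / 2 ≤ (1 + K / 2) ^ L :=
      (by linarith : K / 2 ≤ 1 + K / 2).trans (le_self_pow₀ (by linarith) hL0)
    have h₃ : (1 + K / 2) / C ≤ (1 + K / 2) / (C * Real.log 2) := by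
      gcongr
      exact mul_le_of_le_one_right hC.le hlog1
    calc M = L.factorial * (K / 2 / C ^ L) := by rw [hM]; ring
      _ ≤ (L.factorial ^ L) ^ 2 * ((1 + K / 2) ^ L / C ^ L) := by gcongr
      _ = (L.factorial ^ L) ^ 2 * ((1 + K / 2) / C) ^ L := by rw [div_pow]
      _ ≤ T ^ 2 := by rw [hTsq]; gcongr
  have hmoment : ∀ l, ∫⁻ ω, ENNReal.ofReal ((Z l ω ^ 2) ^ L) ∂μ ≤ ENNReal.ofReal M := by
    intro l
    refine lintegral_pow_le_of_exp_tail ((hmeas l).pow_const 2) (fun _ => sq_nonneg _)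
      (by positivity) hC (fun t ht => ?_) hL0
    have h := htail l (√t) (Real.sqrt_nonneg t)
    rw [Real.sq_sqrt ht] at h
    refine le_trans (measure_mono fun ω hω => ?_) h
    exact Real.sqrt_le_sqrt hω |>.trans_eq (Real.sqrt_sq_eq_abs _)
  have hpoint : ∀ ω, ∏ l, |Z l ω| ≤ T / 2 + (2 * T)⁻¹ * (L : ℝ)⁻¹ * ∑ l, (Z l ω ^ 2) ^ L := by
    intro ω
    have h := sq_prod_abs_le_inv_mul_sum hL0 fun l => Z l ω
    set P := ∏ l, |Z l ω|
    calc P ≤ T / 2 + (2 * T)⁻¹ * P ^ 2 := by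
          have : T / 2 + (2 * T)⁻¹ * P ^ 2 - P = (2 * T)⁻¹ * (T - P) ^ 2 := by
            field_simp
            ring
          have : 0 ≤ (2 * T)⁻¹ * (T - P) ^ 2 := by positivity
          linarith
      _ ≤ _ := by
          rw [mul_assoc]
          gcongr
  calc ∫⁻ ω, ENNReal.ofReal (∏ l, |Z l ω|) ∂μ
      ≤ ∫⁻ ω, (ENNReal.ofReal (T / 2) + ENNReal.ofReal ((2 * T)⁻¹ * (L : ℝ)⁻¹)
          * ∑ l, ENNReal.ofReal ((Z l ω ^ 2) ^ L)) ∂μ := by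
        refine lintegral_mono fun ω => ?_
        rw [← ENNReal.ofReal_sum_of_nonneg fun _ _ => by positivity,
          ← ENNReal.ofReal_mul (by positivity),
          ← ENNReal.ofReal_add (by positivity) (by positivity)]
        exact ENNReal.ofReal_le_ofReal (hpoint ω)
    _ = ENNReal.ofReal (T / 2) + ENNReal.ofReal ((2 * T)⁻¹ * (L : ℝ)⁻¹)
          * ∑ l, ∫⁻ ω, ENNReal.ofReal ((Z l ω ^ 2) ^ L) ∂μ := by
        rw [lintegral_add_left measurable_const, lintegral_const_mul' _ _ ENNReal.ofReal_ne_top,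
          lintegral_finsetSum _ fun l _ => by fun_prop]
        simp
    _ ≤ ENNReal.ofReal (T / 2) + ENNReal.ofReal ((2 * T)⁻¹ * (L : ℝ)⁻¹)
          * ∑ _l : Fin L, ENNReal.ofReal M := by
        gcongr with l
        exact hmoment l
    _ = ENNReal.ofReal (T / 2 + (2 * T)⁻¹ * M) := by
        rw [← ENNReal.ofReal_sum_of_nonneg fun _ _ => hMpos.le,
          ← ENNReal.ofReal_mul (by positivity),
          ← ENNReal.ofReal_add (by positivity) (by simp; positivity)]
        congr 1
        simp only [sum_const, card_univ, Fintype.card_fin, nsmul_eq_mul]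
        field_simp
    _ ≤ ENNReal.ofReal T := by
        refine ENNReal.ofReal_le_ofReal ?_
        calc T / 2 + (2 * T)⁻¹ * M ≤ T / 2 + (2 * T)⁻¹ * T ^ 2 := by gcongr
          _ = T := by field_simp; ring
end

section
/- Let z = Xφ + ξ with X an n×m real matrix, φ, and ξ ∈ ℝ^n, and let λ > 0. Define φ* ∈ ℝ^m by φ*_k = φ_k·1{|φ_k| ≥ λ}, let J* = {k : φ*_k ≠ 0} and s* = |J*|, and assume s* ≥ 1. Assume (1/n)‖X'ξ‖_∞ ≤ λ/4, and assume the compatibility condition with constant κ² > 0: for every R ⊆ {1,…,m} with |R| ≤ s* and every δ ∈ ℝ^m with δ ≠ 0 and ‖δ_{Rᶜ}‖₁ ≤ 3‖δ_R‖₁, one has δ'(X'X/n)δ ≥ κ²·‖δ_R‖₁²/s*. Then any minimizer φ̂ over ℝ^m of δ ↦ (1/n)‖z − Xδ‖² + 2λ‖δ‖₁ satisfies (1/n)‖X(φ̂ − φ)‖² + λ‖φ̂ − φ‖₁ ≤ (3/n)‖X(φ* − φ)‖² + 48·λ²·s*/κ² + λ‖φ* − φ‖₁. -/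
open Finset Matrix

/-- Hölder's inequality for the `ℓ₁`/`ℓ_∞` pairing of `Xᵀξ` with `δ`. -/
lemma sum_mul_mulVec_le {ι κ : Type*} [Fintype ι] [Fintype κ] (X : Matrix ι κ ℝ)
    (ξ : ι → ℝ) (δ : κ → ℝ) (c C : ℝ) (h : ∀ k, |c * ∑ i, X i k * ξ i| ≤ C) :
    c * ∑ i, ξ i * X.mulVec δ i ≤ C * ∑ k, |δ k| := by
  have key : c * ∑ i, ξ i * X.mulVec δ i = ∑ k, (c * ∑ i, X i k * ξ i) * δ k := by
    simp only [mulVec, dotProduct, mul_sum, sum_mul]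
    rw [sum_comm]
    exact sum_congr rfl fun k _ => sum_congr rfl fun i _ => by ring
  rw [key, mul_sum]
  refine sum_le_sum fun k _ => (le_abs_self _).trans ?_
  rw [abs_mul]
  exact mul_le_mul_of_nonneg_right (h k) (abs_nonneg _)

/-- The Gram quadratic form is the squared norm of the image. -/
lemma dotProduct_gram_mulVec {ι κ : Type*} [Fintype ι] [Fintype κ] (X : Matrix ι κ ℝ)
    (δ : κ → ℝ) : δ ⬝ᵥ (Xᵀ * X).mulVec δ = ∑ i, X.mulVec δ i ^ 2 := by
  rw [← mulVec_mulVec, dotProduct_mulVec, vecMul_transpose]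
  simp only [dotProduct, sq]

/-- The `ℓ₁` norm drops by at most the error on a set supporting `b`, and grows by the error
off that set. -/
lemma sum_abs_add_sum_compl_abs_sub_le {κ : Type*} [Fintype κ] [DecidableEq κ] (a b : κ → ℝ)
    (J : Finset κ) (hJ : ∀ k ∉ J, b k = 0) :
    ∑ k, |b k| + ∑ k ∈ Jᶜ, |a k - b k| ≤ ∑ k, |a k| + ∑ k ∈ J, |a k - b k| := by
  have hb : ∑ k ∈ Jᶜ, |b k| = 0 :=
    sum_eq_zero fun k hk => by simp [hJ k (mem_compl.mp hk)]
  have ha : ∑ k ∈ Jᶜ, |a k - b k| = ∑ k ∈ Jᶜ, |a k| :=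
    sum_congr rfl fun k hk => by simp [hJ k (mem_compl.mp hk)]
  have hle : ∑ k ∈ J, |b k| ≤ ∑ k ∈ J, |a k| + ∑ k ∈ J, |a k - b k| := by
    rw [← sum_add_distrib]
    refine sum_le_sum fun k _ => ?_
    have := abs_sub_abs_le_abs_sub (b k) (a k)
    rw [abs_sub_comm] at this
    linarith
  rw [← sum_add_sum_compl J fun k => |b k|, ← sum_add_sum_compl J fun k => |a k|]
  linarith

/-- The basic inequality for a minimizer of the Lasso objective, compared with `b`. -/
lemma lasso_basic_inequality {ι κ : Type*} [Fintype ι] [Fintype κ] (X : Matrix ι κ ℝ)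
    (φ a b : κ → ℝ) (ξ : ι → ℝ) (c C μ : ℝ) (h : ∀ k, |c * ∑ i, X i k * ξ i| ≤ C)
    (hab : c * (∑ i, ((X.mulVec φ + ξ) i - X.mulVec a i) ^ 2) + μ * (∑ k, |a k|)
      ≤ c * (∑ i, ((X.mulVec φ + ξ) i - X.mulVec b i) ^ 2) + μ * (∑ k, |b k|)) :
    c * (∑ i, X.mulVec (a - φ) i ^ 2) + μ * (∑ k, |a k|)
      ≤ c * (∑ i, X.mulVec (b - φ) i ^ 2) + 2 * C * (∑ k, |a k - b k|)
        + μ * (∑ k, |b k|) := by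
  have hexp : ∀ d : κ → ℝ, ∑ i, ((X.mulVec φ + ξ) i - X.mulVec d i) ^ 2
      = ∑ i, ξ i ^ 2 - 2 * ∑ i, ξ i * X.mulVec (d - φ) i
        + ∑ i, X.mulVec (d - φ) i ^ 2 := by
    intro d
    rw [mul_sum, ← sum_sub_distrib, ← sum_add_distrib]
    refine sum_congr rfl fun i _ => ?_
    simp only [mulVec_sub, Pi.add_apply, Pi.sub_apply]
    ring
  have hcross : ∑ i, ξ i * X.mulVec (a - b) i
      = ∑ i, ξ i * X.mulVec (a - φ) i - ∑ i, ξ i * X.mulVec (b - φ) i := by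
    rw [← sum_sub_distrib]
    refine sum_congr rfl fun i _ => ?_
    simp only [mulVec_sub, Pi.sub_apply]
    ring
  have hH := sum_mul_mulVec_le X ξ (a - b) c C h
  rw [hcross] at hH
  simp only [Pi.sub_apply] at hH
  rw [hexp a, hexp b] at hab
  linarith

/-- Lasso oracle inequality with approximate sparsity, following
Section 6.2.3 of van de Geer (2011). -/
theorem stmt17
    (n m : ℕ) (hn : 0 < n) (hm : 0 < m)
    (X : Matrix (Fin n) (Fin m) ℝ) (φ : Fin m → ℝ) (ξ : Fin n → ℝ) (z : Fin n → ℝ)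
    (hz : z = X.mulVec φ + ξ)
    (lam : ℝ) (hlam : 0 < lam)
    -- `φ*` keeps only the coordinates of `φ` of magnitude at least `λ`
    (φstar : Fin m → ℝ)
    (hφstar : ∀ k, φstar k = if lam ≤ |φ k| then φ k else 0)
    (sstar : ℕ)
    (hsstar : sstar = (Finset.univ.filter fun k => φstar k ≠ 0).card)
    (hs1 : 1 ≤ sstar)
    -- `(1/n)‖X'ξ‖_∞ ≤ λ/4`
    (hXξ : ∀ k, |(1 / n) * ∑ i, X i k * ξ i| ≤ lam / 4)
    -- compatibility condition with constant `κ² > 0`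
    (κsq : ℝ) (hκ : 0 < κsq)
    (hcompat : ∀ R : Finset (Fin m), R.card ≤ sstar →
      ∀ δ : Fin m → ℝ, δ ≠ 0 →
      (∑ k ∈ Rᶜ, |δ k|) ≤ 3 * ∑ k ∈ R, |δ k| →
      κsq * (∑ k ∈ R, |δ k|) ^ 2 / (sstar : ℝ) ≤ (δ ⬝ᵥ (Xᵀ * X).mulVec δ) / n)
    -- `φ̂` is a minimizer of the Lasso objective
    (φhat : Fin m → ℝ)
    (hmin : ∀ δ : Fin m → ℝ,
      (1 / n) * (∑ i, (z i - X.mulVec φhat i) ^ 2) + 2 * lam * (∑ k, |φhat k|)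
      ≤ (1 / n) * (∑ i, (z i - X.mulVec δ i) ^ 2) + 2 * lam * (∑ k, |δ k|)) :
    (1 / n) * (∑ i, (X.mulVec (φhat - φ) i) ^ 2) + lam * (∑ k, |φhat k - φ k|)
      ≤ (3 / n) * (∑ i, (X.mulVec (φstar - φ) i) ^ 2)
        + 48 * lam ^ 2 * sstar / κsq
        + lam * (∑ k, |φstar k - φ k|) := by
  subst hz
  have hn' : (0 : ℝ) < n := by exact_mod_cast hn
  have hs' : (0 : ℝ) < sstar := by exact_mod_cast hs1
  set J := univ.filter fun k => φstar k ≠ 0 with hJ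
  have hbasic := lasso_basic_inequality X φ φhat φstar ξ (1 / n) (lam / 4) (2 * lam) hXξ
    (hmin φstar)
  have hsupp := sum_abs_add_sum_compl_abs_sub_le φhat φstar J (by simp [hJ])
  have hsplit := sum_add_sum_compl J fun k => |φhat k - φstar k|
  have htri : ∑ k, |φhat k - φ k| ≤ ∑ k, |φhat k - φstar k| + ∑ k, |φstar k - φ k| := by
    rw [← sum_add_distrib]
    exact sum_le_sum fun k _ => abs_sub_le _ _ _
  have hpar : (1 / n : ℝ) * ∑ i, X.mulVec (φhat - φstar) i ^ 2
      ≤ 2 * ((1 / n) * ∑ i, X.mulVec (φhat - φ) i ^ 2)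
        + 2 * ((1 / n) * ∑ i, X.mulVec (φstar - φ) i ^ 2) := by
    simp only [mul_sum]
    rw [← sum_add_distrib]
    refine sum_le_sum fun i _ => ?_
    have hc : (0 : ℝ) ≤ 1 / n := by positivity
    simp only [mulVec_sub, Pi.sub_apply]
    nlinarith [mul_nonneg hc (sq_nonneg (X.mulVec φhat i + X.mulVec φstar i
      - 2 * X.mulVec φ i))]
  have hcone : (∑ k ∈ Jᶜ, |φhat k - φstar k|) ≤ 3 * ∑ k ∈ J, |φhat k - φstar k| →
      κsq * (∑ k ∈ J, |φhat k - φstar k|) ^ 2 / (sstar : ℝ)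
        ≤ (1 / n : ℝ) * ∑ i, X.mulVec (φhat - φstar) i ^ 2 := by
    intro hc
    by_cases hδ : φhat - φstar = 0
    · have hk : ∀ k, φhat k - φstar k = 0 := fun k => congrFun hδ k
      simp [hδ, hk]
    · have := hcompat J hsstar.ge (φhat - φstar) hδ hc
      rwa [dotProduct_gram_mulVec, div_eq_inv_mul _ (n : ℝ), inv_eq_one_div] at this
  have hQa : 0 ≤ (1 / n : ℝ) * ∑ i, X.mulVec (φhat - φ) i ^ 2 := by positivity
  have hQb : 0 ≤ (1 / n : ℝ) * ∑ i, X.mulVec (φstar - φ) i ^ 2 := by positivity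
  have hthree : (3 / n : ℝ) * ∑ i, X.mulVec (φstar - φ) i ^ 2
      = 3 * ((1 / n) * ∑ i, X.mulVec (φstar - φ) i ^ 2) := by ring
  rw [hthree]
  have hDJ : 0 ≤ ∑ k ∈ J, |φhat k - φstar k| := sum_nonneg fun _ _ => abs_nonneg _
  have hDJc : 0 ≤ ∑ k ∈ Jᶜ, |φhat k - φstar k| := sum_nonneg fun _ _ => abs_nonneg _
  have hpen : 0 ≤ lam ^ 2 * sstar / κsq := by positivity
  have hpen48 : 48 * lam ^ 2 * sstar / κsq = 48 * (lam ^ 2 * sstar / κsq) := by ring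
  rw [hpen48]
  generalize (1 / n : ℝ) * ∑ i, X.mulVec (φhat - φ) i ^ 2 = Qa at *
  generalize (1 / n : ℝ) * ∑ i, X.mulVec (φstar - φ) i ^ 2 = Qb at *
  generalize (1 / n : ℝ) * ∑ i, X.mulVec (φhat - φstar) i ^ 2 = Qd at *
  rw [← hsplit] at hbasic htri
  generalize ∑ k ∈ J, |φhat k - φstar k| = D at *
  generalize ∑ k ∈ Jᶜ, |φhat k - φstar k| = E at *
  have hsupp' := mul_le_mul_of_nonneg_left hsupp hlam.le
  have htri' := mul_le_mul_of_nonneg_left htri hlam.le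
  have hlD := mul_nonneg hlam.le hDJ
  have hlE := mul_nonneg hlam.le hDJc
  rcases le_or_gt E (3 * D) with hc | hc
  · have hyoung : 8 * (lam * D) ≤ κsq * D ^ 2 / sstar / 2 + 32 * (lam ^ 2 * sstar / κsq) := by
      have hsq : κsq * D ^ 2 / sstar / 2 + 32 * (lam ^ 2 * sstar / κsq) - 8 * (lam * D)
          = (κsq * D - 8 * lam * sstar) ^ 2 / (2 * κsq * sstar) := by
        field_simp
        ring
      have : 0 ≤ (κsq * D - 8 * lam * sstar) ^ 2 / (2 * κsq * sstar) := by positivity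
      linarith
    have := hcone hc
    linarith
  · have := mul_le_mul_of_nonneg_left hc.le hlam.le
    linarith
end
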